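/- Let X be a regular Hausdorff topological space with a countable k-network and let Y be a rectifiable topological space with the strong Pytkeev property at every point. Then the function space C_k(X,Y) has the strong Pytkeev property at every point. -/

import Mathlib

open Set Filter Topology

/-- A set `A` accumulates at a point `x` if every neighborhood of `x`
contains infinitely many points of `A`. -/
def Accumulates {X : Type*} [TopologicalSpace X] (A : Set X) (x : X) : Prop :=
  ∀ O ∈ 𝓝 x, (O ∩ A).Infinite

/-- A family `𝒩` of subsets is a Pytkeev network at `x`. -/
def IsPytkeevNetworkAt {X : Type*} [TopologicalSpace X] (𝒩 : Set (Set X)) (x : X) : Prop :=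
  ∀ O ∈ 𝓝 x, ∀ A : Set X, Accumulates A x → ∃ N ∈ 𝒩, N ⊆ O ∧ (N ∩ A).Infinite

/-- `X` has the strong Pytkeev property at `x`. -/
def StrongPytkeevAt (X : Type*) [TopologicalSpace X] (x : X) : Prop :=
  ∃ 𝒩 : Set (Set X), 𝒩.Countable ∧ IsPytkeevNetworkAt 𝒩 x

/-- A family `𝒩` of subsets of `X` is a k-network: for every open `U` and compact
`K ⊆ U` there is a finite subfamily `ℱ ⊆ 𝒩` with `K ⊆ ⋃₀ ℱ ⊆ U`. -/
def IsKNetwork {X : Type*} [TopologicalSpace X] (𝒩 : Set (Set X)) : Prop :=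
  ∀ U : Set X, IsOpen U → ∀ K : Set X, IsCompact K → K ⊆ U →
    ∃ ℱ ⊆ 𝒩, ℱ.Finite ∧ K ⊆ ⋃₀ ℱ ∧ ⋃₀ ℱ ⊆ U

/-- A topological space `Y` is rectifiable if there is a point `e ∈ Y` and a
homeomorphism `H : Y × Y ≃ₜ Y × Y` such that `H (y, e) = (y, y)` for all `y` and
`H` preserves the first coordinate. -/
def Rectifiable (Y : Type*) [TopologicalSpace Y] : Prop :=
  ∃ e : Y, ∃ H : Y × Y ≃ₜ Y × Y,
    (∀ y : Y, H (y, e) = (y, y)) ∧ ∀ q : Y × Y, (H q).1 = q.1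

/-- The finite unions of members of `𝒩`, each enlarged by all points inseparable from `x`
in the sense of lying in every neighborhood of `x`. -/
def finiteUnionsWithKer {X : Type*} [TopologicalSpace X] (𝒩 : Set (Set X)) (x : X) :
    Set (Set X) :=
  (fun ℱ : Set (Set X) ↦ (𝓝 x).ker ∪ ⋃₀ ℱ) '' {ℱ | ℱ.Finite ∧ ℱ ⊆ 𝒩}

/-- The finite intersections of finite unions of members of `𝒦`. -/
def finiteInterUnions {X : Type*} (𝒦 : Set (Set X)) : Set (Set X) :=
  sInter '' {𝒢 | 𝒢.Finite ∧ 𝒢 ⊆ sUnion '' {ℱ | ℱ.Finite ∧ ℱ ⊆ 𝒦}}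

theorem Set.Countable.finiteUnionsWithKer {X : Type*} [TopologicalSpace X] {𝒩 : Set (Set X)}
    (h : 𝒩.Countable) (x : X) : (finiteUnionsWithKer 𝒩 x).Countable :=
  (countable_ofPred_finite_subset h).image _

theorem Set.Countable.finiteInterUnions {X : Type*} {𝒦 : Set (Set X)} (h : 𝒦.Countable) :
    (finiteInterUnions 𝒦).Countable :=
  (countable_ofPred_finite_subset ((countable_ofPred_finite_subset h).image _)).image _

/-- A union of sets missing every point of the kernel of `𝓝 x`, if it does not accumulate at `x`,
is disjoint from a neighborhood of `x`. -/
theorem exists_nhds_disjoint_of_not_accumulates {X : Type*} [TopologicalSpace X] {x : X}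
    {B : ℕ → Set X} (h : ¬ Accumulates (⋃ n, B n) x) (hd : ∀ n, Disjoint (𝓝 x).ker (B n)) :
    ∃ V ∈ 𝓝 x, ∀ n, Disjoint V (B n) := by
  simp only [Accumulates, not_forall, not_infinite] at h
  obtain ⟨O, hO, hfin⟩ := h
  have hex (y : X) (hy : y ∈ O ∩ ⋃ n, B n) : ∃ V ∈ 𝓝 x, y ∉ V := by
    obtain ⟨n, hn⟩ := mem_iUnion.1 hy.2
    simpa [Filter.mem_ker] using disjoint_right.1 (hd n) hn
  choose! V hV hyV using hex
  refine ⟨O ∩ ⋂ y ∈ O ∩ ⋃ n, B n, V y, inter_mem hO ((biInter_mem hfin).2 hV),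
    fun n ↦ disjoint_left.2 fun y hy hyB ↦ ?_⟩
  have hmem : y ∈ O ∩ ⋃ n, B n := ⟨hy.1, mem_iUnion.2 ⟨n, hyB⟩⟩
  exact hyV y hmem (mem_iInter₂.1 hy.2 y hmem)

/-- Every neighborhood contains an increasing sequence of enlarged finite unions of network
elements, and a sequence of finite sets escaping it stays away from the point. -/
theorem IsPytkeevNetworkAt.exists_monotone_seq {X : Type*} [TopologicalSpace X]
    {𝒩 : Set (Set X)} {x : X} (h𝒩 : IsPytkeevNetworkAt 𝒩 x) (hc : 𝒩.Countable)
    {U : Set X} (hU : U ∈ 𝓝 x) :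
    ∃ N : ℕ → Set X, Monotone N ∧ (∀ n, N n ⊆ U) ∧ (∀ n, N n ∈ finiteUnionsWithKer 𝒩 x) ∧
      ∀ B : ℕ → Set X, (∀ n, (B n).Finite) → (∀ n, Disjoint (N n) (B n)) →
        ∃ V ∈ 𝓝 x, ∀ n, Disjoint V (B n) := by
  by_cases hne : {N ∈ 𝒩 | N ⊆ U}.Nonempty
  swap
  · refine ⟨fun _ ↦ (𝓝 x).ker, monotone_const, fun _ ↦ sInter_subset_of_mem hU,
      fun _ ↦ ⟨∅, by simp⟩, fun B hB hd ↦ ?_⟩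
    by_cases hacc : Accumulates (⋃ n, B n) x
    · obtain ⟨N, hN, hNU, -⟩ := h𝒩 U hU _ hacc
      exact (hne ⟨N, hN, hNU⟩).elim
    · exact exists_nhds_disjoint_of_not_accumulates hacc hd
  obtain ⟨M, hM⟩ := (hc.mono (sep_subset 𝒩 (· ⊆ U))).exists_eq_range hne
  have hMmem (n) : M n ∈ 𝒩 ∧ M n ⊆ U := hM.ge (mem_range_self n)
  refine ⟨fun n ↦ (𝓝 x).ker ∪ ⋃₀ (M '' Iic n), fun m n hmn ↦ ?_, fun n ↦ ?_, fun n ↦ ?_,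
    fun B hB hd ↦ ?_⟩
  · exact union_subset_union_right _ (sUnion_subset_sUnion (image_mono (Iic_subset_Iic.2 hmn)))
  · refine union_subset (sInter_subset_of_mem hU) (sUnion_subset ?_)
    rintro _ ⟨m, -, rfl⟩
    exact (hMmem m).2
  · refine ⟨M '' Iic n, ⟨(finite_Iic n).image _, ?_⟩, rfl⟩
    rintro _ ⟨m, -, rfl⟩
    exact (hMmem m).1
  by_cases hacc : Accumulates (⋃ n, B n) x
  · obtain ⟨N, hN, hNU, hinf⟩ := h𝒩 U hU _ hacc
    obtain ⟨m, rfl⟩ : N ∈ range M := hM ▸ ⟨hN, hNU⟩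
    refine (hinf (((finite_Iio m).biUnion fun n _ ↦ hB n).subset ?_)).elim
    rintro y ⟨hyM, hyB⟩
    obtain ⟨n, hn⟩ := mem_iUnion.1 hyB
    refine mem_biUnion (mem_Iio.2 (lt_of_not_ge fun hmn ↦ ?_)) hn
    exact disjoint_left.1 (hd n) (Or.inr ⟨M m, ⟨m, hmn, rfl⟩, hyM⟩) hn
  · exact exists_nhds_disjoint_of_not_accumulates hacc fun n ↦ (hd n).mono_left subset_union_left

/-- In a space with the strong Pytkeev property at `x`, every set with `x` in its closure
contains a sequence with `x` in its closure. -/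
theorem StrongPytkeevAt.exists_seq {X : Type*} [TopologicalSpace X] {x : X}
    (h : StrongPytkeevAt X x) {D : Set X} (hD : x ∈ closure D) :
    ∃ d : ℕ → X, (∀ k, d k ∈ D) ∧ x ∈ closure (range d) := by
  suffices ∃ E ⊆ D, E.Countable ∧ x ∈ closure E by
    obtain ⟨E, hED, hEc, hx⟩ := this
    obtain ⟨d, rfl⟩ := hEc.exists_eq_range (closure_nonempty_iff.1 ⟨x, hx⟩)
    exact ⟨d, fun k ↦ hED (mem_range_self k), hx⟩
  by_cases hacc : Accumulates D x
  · obtain ⟨𝒩, hc, h𝒩⟩ := h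
    have : Nonempty X := ⟨x⟩
    choose! p hp using fun (N : Set X) (hN : (N ∩ D).Nonempty) ↦ hN
    refine ⟨p '' {N ∈ 𝒩 | (N ∩ D).Nonempty}, ?_, (hc.mono (sep_subset _ _)).image p, ?_⟩
    · rintro _ ⟨N, ⟨-, hN⟩, rfl⟩
      exact (hp N hN).2
    · refine mem_closure_iff_nhds.2 fun V hV ↦ ?_
      obtain ⟨N, hN, hNV, hinf⟩ := h𝒩 V hV D hacc
      exact ⟨p N, hNV (hp N hinf.nonempty).1, N, ⟨hN, hinf.nonempty⟩, rfl⟩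
  · simp only [Accumulates, not_forall, not_infinite] at hacc
    obtain ⟨O, hO, hfin⟩ := hacc
    refine ⟨O ∩ D, inter_subset_right, hfin.countable, mem_closure_iff_nhds.2 fun V hV ↦ ?_⟩
    obtain ⟨y, hy, hyD⟩ := mem_closure_iff_nhds.1 hD _ (inter_mem hV hO)
    exact ⟨y, hy.1, hy.2, hyD⟩

/-- A compact set in a space with a countable k-network has a decreasing outer network built from
finite unions and intersections of network elements. -/
theorem IsKNetwork.exists_antitone_seq {X : Type*} [TopologicalSpace X] {𝒦 : Set (Set X)}
    (hk : IsKNetwork 𝒦) (hc : 𝒦.Countable) {C : Set X} (hC : IsCompact C) :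
    ∃ K : ℕ → Set X, Antitone K ∧ (∀ n, K n ∈ finiteInterUnions 𝒦) ∧ (∀ n, C ⊆ K n) ∧
      ∀ W, IsOpen W → C ⊆ W → ∃ n, K n ⊆ W := by
  have key (W : Set X) (hW : IsOpen W) (hCW : C ⊆ W) :
      ∃ L ∈ {L ∈ sUnion '' {ℱ | ℱ.Finite ∧ ℱ ⊆ 𝒦} | C ⊆ L}, L ⊆ W := by
    obtain ⟨ℱ, hℱ, hfin, hCℱ, hℱW⟩ := hk W hW C hC hCW
    exact ⟨⋃₀ ℱ, ⟨⟨ℱ, ⟨hfin, hℱ⟩, rfl⟩, hCℱ⟩, hℱW⟩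
  obtain ⟨L, hL⟩ := (((countable_ofPred_finite_subset hc).image sUnion).mono
    (sep_subset _ (C ⊆ ·))).exists_eq_range
    ((key univ isOpen_univ (subset_univ C)).imp fun _ h ↦ h.1)
  have hLmem (n) : L n ∈ sUnion '' {ℱ | ℱ.Finite ∧ ℱ ⊆ 𝒦} ∧ C ⊆ L n :=
    hL.ge (mem_range_self n)
  refine ⟨fun n ↦ ⋂₀ (L '' Iic n), fun m n hmn ↦ ?_, fun n ↦ ?_, fun n ↦ ?_, fun W hW hCW ↦ ?_⟩
  · exact sInter_subset_sInter (image_mono (Iic_subset_Iic.2 hmn))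
  · refine ⟨L '' Iic n, ⟨(finite_Iic n).image _, ?_⟩, rfl⟩
    rintro _ ⟨m, -, rfl⟩
    exact (hLmem m).1
  · refine subset_sInter ?_
    rintro _ ⟨m, -, rfl⟩
    exact (hLmem m).2
  · obtain ⟨M, hM, hMW⟩ := key W hW hCW
    rw [hL] at hM
    obtain ⟨n, rfl⟩ := hM
    exact ⟨n, (sInter_subset_of_mem (mem_image_of_mem L self_mem_Iic)).trans hMW⟩

/-- A sequence chosen from an outer network of a compact set clusters in that set. -/
theorem IsCompact.exists_mapClusterPt_of_outer_seq {X : Type*} [TopologicalSpace X] {C : Set X}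
    (hC : IsCompact C) {K : ℕ → Set X} (hK : Antitone K)
    (hout : ∀ W, IsOpen W → C ⊆ W → ∃ n, K n ⊆ W) {u : ℕ → X} (hu : ∀ n, u n ∈ K n) :
    ∃ c ∈ C, MapClusterPt c atTop u := by
  by_contra! h
  have hd : Disjoint (𝓝ˢ C) (map u atTop) :=
    hC.disjoint_nhdsSet_left.2 fun c hc ↦ by
      have := h c hc
      rwa [MapClusterPt, ClusterPt, neBot_iff, not_not, ← disjoint_iff] at this
  have hle : map u atTop ≤ 𝓝ˢ C := by
    refine (hasBasis_nhdsSet C).ge_iff.2 fun W hW ↦ ?_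
    obtain ⟨n, hn⟩ := hout W hW.1 hW.2
    exact (eventually_ge_atTop n).mono fun m hm ↦ hn (hK hm (hu m))
  exact (inferInstance : (map u atTop).NeBot).ne (disjoint_self.1 (hd.mono_left hle))

/-- Adding finitely many points of each member of an outer network keeps a compact set compact. -/
theorem IsCompact.union_iUnion_of_outer_seq {X : Type*} [TopologicalSpace X] {C : Set X}
    (hC : IsCompact C) {K : ℕ → Set X} (hK : Antitone K)
    (hout : ∀ W, IsOpen W → C ⊆ W → ∃ n, K n ⊆ W) {S : ℕ → Set X} (hS : ∀ n, (S n).Finite)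
    (hSK : ∀ n, S n ⊆ K n) : IsCompact (C ∪ ⋃ n, S n) := by
  refine isCompact_of_finite_subcover fun {ι} U hUo hU ↦ ?_
  classical
  obtain ⟨t, ht⟩ := hC.elim_finite_subcover U hUo (subset_union_left.trans hU)
  obtain ⟨n, hn⟩ := hout _ (isOpen_biUnion fun i _ ↦ hUo i) ht
  obtain ⟨s, hs⟩ := ((finite_Iio n).biUnion fun m _ ↦ hS m).isCompact.elim_finite_subcover U hUo
    ((iUnion₂_subset fun m _ ↦ subset_iUnion S m).trans (subset_union_right.trans hU))
  refine ⟨t ∪ s, union_subset (ht.trans ?_) (iUnion_subset fun m ↦ ?_)⟩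
  · exact biUnion_subset_biUnion_left fun i hi ↦ Finset.mem_union_left _ hi
  · rcases lt_or_ge m n with hmn | hnm
    · exact (subset_biUnion_of_mem (u := S) (mem_Iio.2 hmn)).trans
        (hs.trans (biUnion_subset_biUnion_left fun i hi ↦ Finset.mem_union_right _ hi))
    · exact ((hSK m).trans ((hK hnm).trans hn)).trans
        (biUnion_subset_biUnion_left fun i hi ↦ Finset.mem_union_left _ hi)

/-- The strong Pytkeev property of `C_k(X,Y)` at a constant function. -/
theorem StrongPytkeevAt.continuousMap_const {X Y : Type*} [TopologicalSpace X]
    [TopologicalSpace Y] {𝒦 : Set (Set X)} (h𝒦 : 𝒦.Countable) (hknet : IsKNetwork 𝒦) {e : Y}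
    (he : StrongPytkeevAt Y e) : StrongPytkeevAt C(X, Y) (ContinuousMap.const X e) := by
  obtain ⟨𝒩, hc, h𝒩⟩ := id he
  refine ⟨image2 (fun K N ↦ {f : C(X, Y) | MapsTo f K N}) (finiteInterUnions 𝒦)
    (finiteUnionsWithKer 𝒩 e), h𝒦.finiteInterUnions.image2 (hc.finiteUnionsWithKer e) _,
    fun O hO A hA ↦ ?_⟩
  obtain ⟨⟨C, U⟩, ⟨hC, hU⟩, hCU⟩ := (𝓝 e).basis_sets.nhds_continuousMapConst.mem_iff.1 hO
  obtain ⟨K, hK, hKmem, hCK, hout⟩ := hknet.exists_antitone_seq h𝒦 hC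
  obtain ⟨N, hN, hNU, hNmem, hesc⟩ := h𝒩.exists_monotone_seq hc hU
  let G (n : ℕ) : Set C(X, Y) := {f | MapsTo f (K n) (N n)}
  suffices ∃ n, (G n ∩ A).Infinite by
    obtain ⟨n, hn⟩ := this
    exact ⟨G n, mem_image2_of_mem (hKmem n) (hNmem n),
      fun f hf ↦ hCU (MapsTo.mono hf (hCK n) (hNU n)), hn⟩
  by_contra! hfin
  have hx (n : ℕ) (f : C(X, Y)) (hf : f ∉ G n) : ∃ x ∈ K n, f x ∉ N n := by
    simpa [G, MapsTo] using hf
  have hX : Nonempty X := by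
    obtain ⟨f, ⟨-, hfA⟩, hf⟩ := ((hA univ univ_mem).sdiff (hfin 0)).nonempty
    exact ⟨(hx 0 f fun h ↦ hf ⟨h, hfA⟩).choose⟩
  choose! x hxK hxN using hx
  obtain ⟨V, hVo, heV, hV⟩ : ∃ V, IsOpen V ∧ e ∈ V ∧
      ∀ f ∈ A, MapsTo f C V → ∃ n, f ∈ G n := by
    have hcl (f : C(X, Y)) (hf : ∀ n, f ∉ G n) : ∃ c ∈ C, MapClusterPt c atTop (x · f) :=
      hC.exists_mapClusterPt_of_outer_seq hK hout fun n ↦ hxK n f (hf n)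
    choose! c hcC hc using hcl
    have hnot : e ∉ closure ((fun f : C(X, Y) ↦ f (c f)) '' {f | ∀ n, f ∉ G n}) := fun hmem ↦ by
      obtain ⟨d, hd, hed⟩ := he.exists_seq hmem
      choose g hg hgd using hd
      obtain ⟨V, hV, hVd⟩ := hesc (fun n ↦ (fun k ↦ g k (x n (g k))) '' Iic n)
        (fun n ↦ (finite_Iic n).image _) (fun n ↦ disjoint_right.2 (by
          rintro _ ⟨k, -, rfl⟩
          exact hxN n _ (hg k n)))
      obtain ⟨_, hkV, k, rfl⟩ := mem_closure_iff_nhds.1 hed _ (interior_mem_nhds.2 hV)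
      rw [← hgd k] at hkV
      have hfreq := (hc _ (hg k)).frequently
        ((g k).continuous.continuousAt.preimage_mem_nhds (isOpen_interior.mem_nhds hkV))
      obtain ⟨n, hn, hkn⟩ := (hfreq.and_eventually (eventually_ge_atTop k)).exists
      exact disjoint_left.1 (hVd n) (interior_subset hn) ⟨k, hkn, rfl⟩
    refine ⟨_, isClosed_closure.isOpen_compl, hnot, fun f _ hf ↦ ?_⟩
    by_contra! hfG
    exact hf (hcC f hfG) (subset_closure ⟨f, hfG, rfl⟩)
  let F (n : ℕ) : Set C(X, Y) := (G (n + 1) ∩ A) \ G n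
  have hF (n) : (F n).Finite := (hfin (n + 1)).sdiff
  obtain ⟨W, hW, hWd⟩ := hesc (fun n ↦ (fun f : C(X, Y) ↦ f (x n f)) '' F n)
    (fun n ↦ (hF n).image _) (fun n ↦ disjoint_right.2 (by
      rintro _ ⟨f, hf, rfl⟩
      exact hxN n f hf.2))
  have hcomp : IsCompact (C ∪ ⋃ n, x n '' F n) :=
    hC.union_iUnion_of_outer_seq hK hout (fun n ↦ (hF n).image _) (fun n ↦ by
      rintro _ ⟨f, hf, rfl⟩
      exact hxK n f hf.2)
  have hnhds := (𝓝 e).basis_sets.nhds_continuousMapConst.mem_of_mem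
    (i := (C ∪ ⋃ n, x n '' F n, V ∩ W)) ⟨hcomp, inter_mem (hVo.mem_nhds heV) hW⟩
  obtain ⟨f, ⟨hf, hfA⟩, hf0⟩ := ((hA _ hnhds).sdiff (hfin 0)).nonempty
  have hex := hV f hfA fun y hy ↦ (hf (Or.inl hy)).1
  classical
  have hpos : Nat.find hex ≠ 0 := fun h0 ↦ hf0 ⟨h0 ▸ Nat.find_spec hex, hfA⟩
  obtain ⟨n, hn⟩ := Nat.exists_eq_add_one_of_ne_zero hpos
  have hfF : f ∈ F n := ⟨⟨hn ▸ Nat.find_spec hex, hfA⟩, Nat.find_min hex (by omega)⟩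
  exact disjoint_left.1 (hWd n) (hf (Or.inr (mem_iUnion.2 ⟨n, f, hfF, rfl⟩))).2 ⟨f, hfF, rfl⟩

/-- Pairing with a fixed continuous function is continuous in the compact-open topology. -/
theorem ContinuousMap.continuous_prodMk_left {X Y Z : Type*} [TopologicalSpace X]
    [RegularSpace X] [TopologicalSpace Y] [TopologicalSpace Z] (f : C(X, Y)) :
    Continuous fun g : C(X, Z) ↦ f.prodMk g := by
  refine continuous_iff_continuousAt.2 fun g ↦
    ContinuousMap.tendsto_nhds_compactOpen.2 fun K hK W hW hmaps ↦ ?_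
  refine hK.induction_on (p := fun S ↦ ∀ᶠ h in 𝓝 g, MapsTo (f.prodMk h) S W)
    (.of_forall fun _ ↦ mapsTo_empty _ _)
    (fun s t hst ht ↦ ht.mono fun h hh ↦ hh.mono_left hst)
    (fun s t hs ht ↦ (hs.and ht).mono fun h hh ↦ hh.1.union hh.2) fun x hx ↦ ?_
  obtain ⟨U, V, hU, hxU, hV, hxV, hUV⟩ := mem_nhds_prod_iff'.1 (hW.mem_nhds (hmaps hx))
  have hmem : f ⁻¹' U ∩ g ⁻¹' V ∈ 𝓝 x :=
    ((hU.preimage f.continuous).inter (hV.preimage g.continuous)).mem_nhds ⟨hxU, hxV⟩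
  obtain ⟨P, hP, hPc, hPsub⟩ := exists_mem_nhds_isClosed_subset hmem
  refine ⟨K ∩ P, inter_mem self_mem_nhdsWithin (mem_nhdsWithin_of_mem_nhds hP), ?_⟩
  filter_upwards [ContinuousMap.eventually_mapsTo (hK.inter_right hPc) hV
    (fun y hy ↦ (hPsub hy.2).2 : MapsTo g (K ∩ P) V)] with h hh y hy
  exact hUV ⟨(hPsub hy.2).1, hh hy⟩

/-- A homeomorphism of `Y × Y` preserving first coordinates acts on `C_k(X,Y)` over each `f`. -/
def Homeomorph.continuousMapOver {X Y : Type*} [TopologicalSpace X] [RegularSpace X]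
    [TopologicalSpace Y] (H : Y × Y ≃ₜ Y × Y) (hH : ∀ q, (H q).1 = q.1) (f : C(X, Y)) :
    C(X, Y) ≃ₜ C(X, Y) where
  toFun g := (ContinuousMap.snd.comp (H : C(Y × Y, Y × Y))).comp (f.prodMk g)
  invFun g := (ContinuousMap.snd.comp (H.symm : C(Y × Y, Y × Y))).comp (f.prodMk g)
  left_inv g := by
    ext x
    have : (f x, (H (f x, g x)).2) = H (f x, g x) := Prod.ext (hH (f x, g x)).symm rfl
    simp [this]
  right_inv g := by
    ext x
    have : (f x, (H.symm (f x, g x)).2) = H.symm (f x, g x) :=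
      Prod.ext (by simpa using hH (H.symm (f x, g x))) rfl
    simp [this]
  continuous_toFun := (ContinuousMap.continuous_postcomp _).comp f.continuous_prodMk_left
  continuous_invFun := (ContinuousMap.continuous_postcomp _).comp f.continuous_prodMk_left

theorem StrongPytkeevAt.homeomorph {X Y : Type*} [TopologicalSpace X] [TopologicalSpace Y]
    (Φ : X ≃ₜ Y) {x : X} (h : StrongPytkeevAt X x) : StrongPytkeevAt Y (Φ x) := by
  obtain ⟨𝒩, hc, h𝒩⟩ := h
  refine ⟨image Φ '' 𝒩, hc.image _, fun O hO A hA ↦ ?_⟩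
  obtain ⟨N, hN, hNO, hinf⟩ := h𝒩 (Φ ⁻¹' O) (Φ.continuous.continuousAt hO) (Φ ⁻¹' A)
    fun V hV ↦ by
      refine Infinite.of_image Φ ((hA _ (Φ.isOpenMap.image_mem_nhds hV)).mono ?_)
      rintro _ ⟨⟨y, hy, rfl⟩, hyA⟩
      exact ⟨y, ⟨hy, hyA⟩, rfl⟩
  refine ⟨Φ '' N, mem_image_of_mem _ hN, image_subset_iff.2 hNO, ?_⟩
  refine (hinf.image Φ.injective.injOn).mono ?_
  rintro _ ⟨y, ⟨hy, hyA⟩, rfl⟩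
  exact ⟨⟨y, hy, rfl⟩, hyA⟩

/-- For a regular Hausdorff space `X` with a countable k-network and a rectifiable
space `Y` with the strong Pytkeev property at every point, the function space
`C_k(X,Y)` has the strong Pytkeev property at every point. -/
theorem strongPytkeev_compactOpen_rectifiable {X Y : Type*} [TopologicalSpace X]
    [T2Space X] [RegularSpace X] [TopologicalSpace Y]
    (𝒦 : Set (Set X)) (h𝒦 : 𝒦.Countable) (hknet : IsKNetwork 𝒦)
    (hrect : Rectifiable Y) (hY : ∀ y : Y, StrongPytkeevAt Y y) :
    ∀ f : C(X, Y), StrongPytkeevAt C(X, Y) f := by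
  obtain ⟨e, H, hHe, hH⟩ := hrect
  intro f
  have hconst : H.continuousMapOver hH f (ContinuousMap.const X e) = f := by
    ext x
    exact congrArg Prod.snd (hHe (f x))
  exact hconst ▸ (StrongPytkeevAt.continuousMap_const h𝒦 hknet (hY e)).homeomorph
    (H.continuousMapOver hH f)
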